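/- Let (X, Y) be bivariate Gaussian with mean zero, variances Σ₁₁, Σ₂₂ and correlation ρ. Then E[max(0,X)²·max(0,Y)²] = (1/(2π)) Σ₁₁Σ₂₂ · (3ρ√(1-ρ²) + (π/2 + arcsin ρ)(1+2ρ²)). -/

import Mathlib

open MeasureTheory ProbabilityTheory

open Real Set

/-- Cramér–Wold in the plane. -/
lemma Measure.ext_of_map_linear_combination {μ ν : Measure (ℝ × ℝ)} [IsFiniteMeasure μ]
    [IsFiniteMeasure ν]
    (h : ∀ a b : ℝ, μ.map (fun p => a * p.1 + b * p.2) = ν.map (fun p => a * p.1 + b * p.2)) :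
    μ = ν := by
  refine Measure.ext_of_charFunDual (funext fun L => ?_)
  have hL : ⇑L = fun p : ℝ × ℝ => L (1, 0) * p.1 + L (0, 1) * p.2 := by
    funext p
    have hp : p = p.1 • ((1 : ℝ), (0 : ℝ)) + p.2 • ((0 : ℝ), (1 : ℝ)) := by ext <;> simp
    conv_lhs => rw [hp, map_add, map_smul, map_smul]
    simp [mul_comm]
  rw [charFunDual_eq_charFun_map_one, charFunDual_eq_charFun_map_one, hL, h]

lemma map_linear_combination_gaussianReal_prod (a b : ℝ) :
    ((gaussianReal 0 1).prod (gaussianReal 0 1)).map (fun p : ℝ × ℝ => a * p.1 + b * p.2) =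
      gaussianReal 0 (Real.toNNReal (a ^ 2 + b ^ 2)) := by
  have hmap (c : ℝ) : (gaussianReal 0 1).map (c * ·) = gaussianReal 0 (Real.toNNReal (c ^ 2)) := by
    rw [gaussianReal_map_const_mul, mul_zero, mul_one]
    congr 1
    ext
    simp [sq_nonneg]
  have hind : IndepFun (fun p : ℝ × ℝ => a * p.1) (fun p : ℝ × ℝ => b * p.2)
      ((gaussianReal 0 1).prod (gaussianReal 0 1)) :=
    indepFun_prod (X := (a * ·)) (Y := (b * ·)) (by fun_prop) (by fun_prop)
  have ha : ((gaussianReal 0 1).prod (gaussianReal 0 1)).map (fun p : ℝ × ℝ => a * p.1) =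
      gaussianReal 0 (Real.toNNReal (a ^ 2)) := by
    rw [← hmap, ← (measurePreserving_fst (μ := gaussianReal 0 1) (ν := gaussianReal 0 1)).map_eq,
      Measure.map_map (by fun_prop) (by fun_prop)]
    simp [Function.comp_def]
  have hb : ((gaussianReal 0 1).prod (gaussianReal 0 1)).map (fun p : ℝ × ℝ => b * p.2) =
      gaussianReal 0 (Real.toNNReal (b ^ 2)) := by
    rw [← hmap, ← (measurePreserving_snd (μ := gaussianReal 0 1) (ν := gaussianReal 0 1)).map_eq,
      Measure.map_map (by fun_prop) (by fun_prop)]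
    simp [Function.comp_def]
  have hadd := gaussianReal_add_gaussianReal_of_indepFun hind ha hb
  rwa [add_zero, ← Real.toNNReal_add (sq_nonneg a) (sq_nonneg b)] at hadd

/-- The standard Gaussian measure of the plane in polar coordinates. -/
lemma integral_gaussianReal_prod_eq_polarCoord (f : ℝ × ℝ → ℝ) :
    ∫ p, f p ∂((gaussianReal 0 1).prod (gaussianReal 0 1)) =
      (1 / (2 * π)) * ∫ p in Ioi (0 : ℝ) ×ˢ Ioo (-π) π,
        p.1 * exp (-(1 / 2) * p.1 ^ 2) * f (p.1 * cos p.2, p.1 * sin p.2) := by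
  rw [gaussianReal_of_var_ne_zero 0 one_ne_zero,
    prod_withDensity (measurable_gaussianPDF 0 1) (measurable_gaussianPDF 0 1),
    integral_withDensity_eq_integral_toReal_smul
      (f := fun z : ℝ × ℝ => gaussianPDF 0 1 z.1 * gaussianPDF 0 1 z.2)
      (((measurable_gaussianPDF 0 1).comp measurable_fst).mul
        ((measurable_gaussianPDF 0 1).comp measurable_snd))
      (ae_of_all _ fun _ => ENNReal.mul_lt_top gaussianPDF_lt_top gaussianPDF_lt_top),
    ← Measure.volume_eq_prod, ← integral_comp_polarCoord_symm, ← integral_const_mul]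
  refine integral_congr_ae (ae_of_all _ fun p => ?_)
  have hexp : exp (-(p.1 * cos p.2) ^ 2 / 2) * exp (-(p.1 * sin p.2) ^ 2 / 2) =
      exp (-(1 / 2) * p.1 ^ 2) := by
    rw [← exp_add]
    congr 1
    linear_combination (-(p.1 ^ 2) / 2) * sin_sq_add_cos_sq p.2
  have hsqrt : (√(2 * π))⁻¹ * (√(2 * π))⁻¹ = 1 / (2 * π) := by
    rw [← mul_inv, mul_self_sqrt (by positivity), one_div]
  simp only [polarCoord_symm_apply, ENNReal.toReal_mul, toReal_gaussianPDF, gaussianPDFReal,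
    smul_eq_mul, sub_zero, NNReal.coe_one, mul_one]
  rw [← hexp, ← hsqrt]
  ring

lemma integral_pow_five_mul_exp_neg_half_mul_sq :
    ∫ r in Ioi (0 : ℝ), r ^ 5 * exp (-(1 / 2) * r ^ 2) = 8 := by
  have h := integral_rpow_mul_exp_neg_mul_rpow (p := 2) (q := 5) (b := 1 / 2)
    (by norm_num) (by norm_num) (by norm_num)
  norm_num at h
  have h3 : Gamma 3 = 2 := by simp
  have h8 : ((1 : ℝ) / 2) ^ (-3 : ℝ) = 8 := by
    rw [rpow_neg (by norm_num)]
    norm_num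
  norm_num [h3, h8] at h ⊢
  exact h

lemma integral_cos_sq_mul_sin_add_sq (α : ℝ) :
    ∫ θ in (-α)..(π / 2), cos θ ^ 2 * sin (θ + α) ^ 2 =
      (1 / 8) * (3 * sin α * cos α + (π / 2 + α) * (1 + 2 * sin α ^ 2)) := by
  have hderiv (θ : ℝ) : HasDerivAt
      (fun θ => (1 / 4) * (θ / 2 - sin (4 * θ + 2 * α) / 8 - sin α * cos (2 * θ + α)
        + sin α ^ 2 * θ)) (cos θ ^ 2 * sin (θ + α) ^ 2) θ := by
    have h4 : HasDerivAt (fun θ => 4 * θ + 2 * α) 4 θ := by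
      simpa using ((hasDerivAt_id θ).const_mul 4).add_const (2 * α)
    have h2 : HasDerivAt (fun θ => 2 * θ + α) 2 θ := by
      simpa using ((hasDerivAt_id θ).const_mul 2).add_const α
    convert! ((((hasDerivAt_id θ).div_const 2).sub (h4.sin.div_const 8)).sub
      (h2.cos.const_mul (sin α))).add ((hasDerivAt_id θ).const_mul (sin α ^ 2)) |>.const_mul
        (1 / 4 : ℝ) using 1
    have hc : cos (4 * θ + 2 * α) = 1 - 2 * sin (2 * θ + α) ^ 2 := by
      rw [show 4 * θ + 2 * α = 2 * (2 * θ + α) by ring, cos_two_mul, cos_sq']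
      ring
    have hprod : cos θ * sin (θ + α) = (sin (2 * θ + α) + sin α) / 2 := by
      have h1 : sin (2 * θ + α) = sin ((θ + α) + θ) := by ring_nf
      have h2 : sin α = sin ((θ + α) - θ) := by ring_nf
      rw [h1, h2, sin_add (θ + α) θ, sin_sub]
      ring
    rw [hc, ← mul_pow, hprod]
    ring
  rw [intervalIntegral.integral_eq_sub_of_hasDerivAt (fun θ _ => hderiv θ)
    (Continuous.intervalIntegrable (by fun_prop) _ _)]
  have e1 : sin (4 * (π / 2) + 2 * α) = 2 * sin α * cos α := by
    rw [← sin_two_mul, ← sin_add_two_pi (2 * α)]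
    ring_nf
  have e2 : cos (2 * (π / 2) + α) = - cos α := by
    rw [← cos_add_pi α]
    ring_nf
  have e3 : sin (4 * (-α) + 2 * α) = -(2 * sin α * cos α) := by
    rw [← sin_two_mul, ← sin_neg]
    ring_nf
  have e4 : cos (2 * (-α) + α) = cos α := by
    rw [← cos_neg α]
    ring_nf
  rw [e1, e2, e3, e4]
  ring

lemma integral_max_cos_sq_mul_max_sin_add_sq {α : ℝ} (h₁ : -(π / 2) ≤ α) (h₂ : α ≤ π / 2) :
    ∫ θ in Ioo (-π) π, max 0 (cos θ) ^ 2 * max 0 (sin (θ + α)) ^ 2 =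
      (1 / 8) * (3 * sin α * cos α + (π / 2 + α) * (1 + 2 * sin α ^ 2)) := by
  have hπ := pi_pos
  rw [← integral_cos_sq_mul_sin_add_sq, intervalIntegral.integral_of_le (by linarith),
    integral_Ioc_eq_integral_Ioo]
  have hsub : Ioo (-α) (π / 2) ⊆ Ioo (-π) π := fun θ hθ =>
    ⟨by linarith [hθ.1], by linarith [hθ.2]⟩
  rw [setIntegral_eq_of_subset_of_forall_sdiff_eq_zero measurableSet_Ioo hsub]
  · refine setIntegral_congr_fun measurableSet_Ioo fun θ hθ => ?_
    have hc : 0 ≤ cos θ := cos_nonneg_of_mem_Icc ⟨by linarith [hθ.1], hθ.2.le⟩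
    have hs : 0 ≤ sin (θ + α) :=
      sin_nonneg_of_nonneg_of_le_pi (by linarith [hθ.1]) (by linarith [hθ.2])
    simp only [max_eq_right hc, max_eq_right hs]
  · rintro θ ⟨hθ, hnot⟩
    rcases le_or_gt (cos θ) 0 with hc | hc
    · simp [max_eq_left hc]
    have hlt : θ < π / 2 := by
      by_contra! hge
      exact hc.not_ge (cos_nonpos_of_pi_div_two_le_of_le hge (by linarith [hθ.2]))
    have hgt : -(π / 2) < θ := by
      by_contra! hle
      refine hc.not_ge ?_
      rw [← cos_neg]
      exact cos_nonpos_of_pi_div_two_le_of_le (by linarith) (by linarith [hθ.1])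
    have hle : θ ≤ -α := by
      by_contra! hcon
      exact hnot ⟨hcon, hlt⟩
    have hs : sin (θ + α) ≤ 0 :=
      sin_nonpos_of_nonpos_of_neg_pi_le (by linarith) (by linarith)
    simp [max_eq_left hs]

lemma integral_max_sq_mul_max_sq_gaussianReal_prod {α : ℝ} (h₁ : -(π / 2) ≤ α)
    (h₂ : α ≤ π / 2) :
    ∫ p : ℝ × ℝ, max 0 p.1 ^ 2 * max 0 (sin α * p.1 + cos α * p.2) ^ 2
        ∂((gaussianReal 0 1).prod (gaussianReal 0 1)) =
      (1 / (2 * π)) * (3 * sin α * cos α + (π / 2 + α) * (1 + 2 * sin α ^ 2)) := by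
  have hpolar : ∀ p ∈ Ioi (0 : ℝ) ×ˢ Ioo (-π) π,
      p.1 * exp (-(1 / 2) * p.1 ^ 2) * (max 0 (p.1 * cos p.2) ^ 2 *
        max 0 (sin α * (p.1 * cos p.2) + cos α * (p.1 * sin p.2)) ^ 2) =
      (p.1 ^ 5 * exp (-(1 / 2) * p.1 ^ 2)) *
        (max 0 (cos p.2) ^ 2 * max 0 (sin (p.2 + α)) ^ 2) := by
    rintro p ⟨hp, -⟩
    have hr : 0 ≤ p.1 := le_of_lt hp
    have hscale (x : ℝ) : max 0 (p.1 * x) = p.1 * max 0 x := by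
      rw [mul_max_of_nonneg _ _ hr, mul_zero]
    rw [show sin α * (p.1 * cos p.2) + cos α * (p.1 * sin p.2) = p.1 * sin (p.2 + α) by
      rw [sin_add]; ring, hscale, hscale]
    ring
  rw [integral_gaussianReal_prod_eq_polarCoord,
    setIntegral_congr_fun (measurableSet_Ioi.prod measurableSet_Ioo) hpolar,
    Measure.volume_eq_prod,
    setIntegral_prod_mul (fun r => r ^ 5 * exp (-(1 / 2) * r ^ 2))
      (fun θ => max 0 (cos θ) ^ 2 * max 0 (sin (θ + α)) ^ 2),
    integral_pow_five_mul_exp_neg_half_mul_sq, integral_max_cos_sq_mul_max_sin_add_sq h₁ h₂]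
  ring

/-- For a centred bivariate Gaussian `(X,Y)` with variances `S11, S22` and
correlation `ρ = S12 / √(S11 S22)`,
`E[max 0 X² · max 0 Y²] = (1/(2π)) S11 S22 (3ρ√(1-ρ²) + (π/2 + arcsin ρ)(1+2ρ²))`. -/
theorem stmt_4 {Ω : Type*} [MeasurableSpace Ω] (P : Measure Ω) [IsProbabilityMeasure P]
    (X Y : Ω → ℝ) (S11 S12 S22 : ℝ) (h11 : 0 < S11) (h22 : 0 < S22)
    (hcorr : |S12 / Real.sqrt (S11 * S22)| ≤ 1)
    (hgauss : ∀ a b : ℝ,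
      Measure.map (fun ω => a * X ω + b * Y ω) P =
        gaussianReal 0 (Real.toNNReal (a ^ 2 * S11 + 2 * a * b * S12 + b ^ 2 * S22))) :
    ∫ ω, max 0 (X ω) ^ 2 * max 0 (Y ω) ^ 2 ∂P =
      (1 / (2 * Real.pi)) * (S11 * S22) *
        (3 * (S12 / Real.sqrt (S11 * S22)) *
            Real.sqrt (1 - (S12 / Real.sqrt (S11 * S22)) ^ 2) +
          (Real.pi / 2 + Real.arcsin (S12 / Real.sqrt (S11 * S22))) *
            (1 + 2 * (S12 / Real.sqrt (S11 * S22)) ^ 2)) := by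
  set ρ := S12 / √(S11 * S22) with hρ
  set α := arcsin ρ with hα
  obtain ⟨hlow, hhigh⟩ := abs_le.mp hcorr
  have hsin : sin α = ρ := sin_arcsin hlow hhigh
  have hcos : cos α = √(1 - ρ ^ 2) := cos_arcsin ρ
  have hS12 : S12 = √S11 * √S22 * sin α := by
    rw [hsin, hρ, ← sqrt_mul h11.le]
    field_simp
  have hX : AEMeasurable X P := by
    refine AEMeasurable.of_map_ne_zero ?_
    have h := hgauss 1 0
    simp only [one_mul, zero_mul, add_zero] at h
    rw [h]
    exact NeZero.ne _
  have hY : AEMeasurable Y P := by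
    refine AEMeasurable.of_map_ne_zero ?_
    have h := hgauss 0 1
    simp only [one_mul, zero_mul, zero_add] at h
    rw [h]
    exact NeZero.ne _
  let T : ℝ × ℝ → ℝ × ℝ := fun p => (√S11 * p.1, √S22 * (sin α * p.1 + cos α * p.2))
  have hT : Measurable T := by fun_prop
  have hlaw : P.map (fun ω => (X ω, Y ω)) =
      ((gaussianReal 0 1).prod (gaussianReal 0 1)).map T := by
    have := Measure.isProbabilityMeasure_map (μ := P) (hX.prodMk hY)
    have := Measure.isProbabilityMeasure_map
      (μ := (gaussianReal 0 1).prod (gaussianReal 0 1)) hT.aemeasurable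
    refine Measure.ext_of_map_linear_combination fun a b => ?_
    rw [AEMeasurable.map_map_of_aemeasurable (by fun_prop) (hX.prodMk hY),
      Measure.map_map (by fun_prop) hT]
    refine (hgauss a b).trans ?_
    have hcomp : (fun p : ℝ × ℝ => a * p.1 + b * p.2) ∘ T = fun p =>
        (a * √S11 + b * √S22 * sin α) * p.1 + (b * √S22 * cos α) * p.2 := by
      funext p
      simp only [T, Function.comp_apply]
      ring
    rw [hcomp, map_linear_combination_gaussianReal_prod, hS12]
    congr 2
    linear_combination (-a ^ 2) * sq_sqrt h11.le - b ^ 2 * sq_sqrt h22.le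
      - b ^ 2 * √S22 ^ 2 * sin_sq_add_cos_sq α
  have hf : Measurable fun p : ℝ × ℝ => max 0 p.1 ^ 2 * max 0 p.2 ^ 2 := by fun_prop
  have hscale (s x : ℝ) : max 0 (√s * x) = √s * max 0 x := by
    rw [mul_max_of_nonneg _ _ (sqrt_nonneg s), mul_zero]
  calc ∫ ω, max 0 (X ω) ^ 2 * max 0 (Y ω) ^ 2 ∂P
      = ∫ p, max 0 p.1 ^ 2 * max 0 p.2 ^ 2 ∂(P.map fun ω => (X ω, Y ω)) :=
        (integral_map (hX.prodMk hY) hf.aestronglyMeasurable).symm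
    _ = ∫ p : ℝ × ℝ, (S11 * S22) * (max 0 p.1 ^ 2 * max 0 (sin α * p.1 + cos α * p.2) ^ 2)
          ∂((gaussianReal 0 1).prod (gaussianReal 0 1)) := by
        rw [hlaw, integral_map hT.aemeasurable hf.aestronglyMeasurable]
        refine integral_congr_ae (ae_of_all _ fun p => ?_)
        simp only [T, hscale, mul_pow, sq_sqrt h11.le, sq_sqrt h22.le]
        ring
    _ = _ := by
        rw [integral_const_mul, integral_max_sq_mul_max_sq_gaussianReal_prod
          (neg_pi_div_two_le_arcsin ρ) (arcsin_le_pi_div_two ρ), hcos, hsin]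
        ring
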